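/- In a symmetric WCMDP, for any stationary policy π there exists a permutation-invariant stationary policy π̄ (satisfying π̄(Qs,Qa) = π̄(s,a) for all permutations Q) whose value vector is the constant vector whose entries all equal the average of the components of the value vector of π: V^{π̄}_0 = ((1/N)∑_{n=1}^N V^π_{0,n})·1. -/

import Mathlib

open Finset

/-- Joint transition of `N` independent identical sub-MDPs with individual
kernel `p s a s'`. -/
def jointP {N : ℕ} {S A : Type*} [Fintype S] (p : S → A → S → ℝ)
    (s : Fin N → S) (a : Fin N → A) (s' : Fin N → S) : ℝ :=
  ∏ n, p (s n) (a n) (s' n)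

/-- Time-`t` joint state-action distribution under stationary joint policy `π`,
initial distribution `μ`: `P^π(s_t = s, a_t = a | s_0 ∼ μ)`. -/
def jsaDist {N : ℕ} {S A : Type*} [Fintype S] [Fintype A]
    (μ : (Fin N → S) → ℝ) (π : (Fin N → S) → (Fin N → A) → ℝ)
    (p : S → A → S → ℝ) : ℕ → ((Fin N → S) × (Fin N → A)) → ℝ
  | 0 => fun q => μ q.1 * π q.1 q.2
  | (t + 1) => fun q =>
      π q.1 q.2 * ∑ q' : (Fin N → S) × (Fin N → A),
        jsaDist μ π p t q' * jointP p q'.1 q'.2 q.1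

/-- `jVal γ μ π p r0 n` is the expected total discounted reward of the `n`-th
sub-MDP under joint policy `π`, i.e. the `n`-th component of `V^π_0`. -/
noncomputable def jVal {N : ℕ} {S A : Type*} [Fintype S] [Fintype A]
    (γ : ℝ) (μ : (Fin N → S) → ℝ) (π : (Fin N → S) → (Fin N → A) → ℝ)
    (p : S → A → S → ℝ) (r0 : S → A → ℝ) (n : Fin N) : ℝ :=
  ∑' t : ℕ, γ ^ t * ∑ q : (Fin N → S) × (Fin N → A),
    jsaDist μ π p t q * r0 (q.1 n) (q.2 n)


section helpers
variable {N : ℕ} {S A : Type*} [Fintype S] [Fintype A]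

lemma jointP_nonneg (p : S → A → S → ℝ) (hp0 : ∀ s a s', 0 ≤ p s a s')
    (s : Fin N → S) (a : Fin N → A) (s' : Fin N → S) : 0 ≤ jointP p s a s' :=
  Finset.prod_nonneg fun _ _ => hp0 _ _ _

lemma jointP_sum (p : S → A → S → ℝ) (hp1 : ∀ s a, ∑ s', p s a s' = 1)
    (s : Fin N → S) (a : Fin N → A) : ∑ s', jointP p s a s' = 1 := by
  classical
  unfold jointP
  have h := Finset.prod_univ_sum (fun _ : Fin N => (Finset.univ : Finset S))
    (fun n x => p (s n) (a n) x)
  rw [Fintype.piFinset_univ] at h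
  rw [← h]
  simp [hp1]

lemma jointP_perm (p : S → A → S → ℝ) (Q : Equiv.Perm (Fin N))
    (s : Fin N → S) (a : Fin N → A) (s' : Fin N → S) :
    jointP p (s ∘ Q) (a ∘ Q) (s' ∘ Q) = jointP p s a s' := by
  unfold jointP
  exact Equiv.prod_comp Q (fun n => p (s n) (a n) (s' n))

lemma sum_perm {T : Type*} [Fintype T] (Q : Equiv.Perm (Fin N)) (f : (Fin N → T) → ℝ) :
    ∑ s, f (s ∘ Q) = ∑ s, f s :=
  Equiv.sum_comp (Equiv.arrowCongr Q.symm (Equiv.refl T)) f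

lemma sum_perm2 (Q : Equiv.Perm (Fin N)) (f : ((Fin N → S) × (Fin N → A)) → ℝ) :
    ∑ q : (Fin N → S) × (Fin N → A), f (q.1 ∘ Q, q.2 ∘ Q) = ∑ q, f q := by
  exact Equiv.sum_comp ((Equiv.arrowCongr Q.symm (Equiv.refl S)).prodCongr
    (Equiv.arrowCongr Q.symm (Equiv.refl A))) f

variable (γ : ℝ) (μ : (Fin N → S) → ℝ) (π : (Fin N → S) → (Fin N → A) → ℝ)
    (p : S → A → S → ℝ)

lemma jsa_nonneg (hp0 : ∀ s a s', 0 ≤ p s a s') (hμ0 : ∀ s, 0 ≤ μ s)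
    (hπ0 : ∀ s a, 0 ≤ π s a) (t : ℕ) : ∀ q, 0 ≤ jsaDist μ π p t q := by
  induction t with
  | zero => intro q; exact mul_nonneg (hμ0 _) (hπ0 _ _)
  | succ t ih =>
    intro q
    exact mul_nonneg (hπ0 _ _) (Finset.sum_nonneg fun q' _ =>
      mul_nonneg (ih q') (jointP_nonneg p hp0 _ _ _))

lemma jsa_sum (hp1 : ∀ s a, ∑ s', p s a s' = 1) (hμ1 : ∑ s, μ s = 1)
    (hπ1 : ∀ s, ∑ a, π s a = 1) (t : ℕ) : ∑ q, jsaDist μ π p t q = 1 := by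
  induction t with
  | zero =>
    simp only [jsaDist, Fintype.sum_prod_type]
    simp [← Finset.mul_sum, hπ1, hμ1]
  | succ t ih =>
    simp only [jsaDist]
    rw [Fintype.sum_prod_type]
    simp only [← Finset.sum_mul, hπ1, one_mul]
    rw [Finset.sum_comm]
    simp only [← Finset.mul_sum, jointP_sum p hp1, mul_one, ih]

noncomputable def occ (q : (Fin N → S) × (Fin N → A)) : ℝ :=
  ∑' t : ℕ, γ ^ t * jsaDist μ π p t q

noncomputable def flow (s : Fin N → S) : ℝ :=
  μ s + γ * ∑ q' : (Fin N → S) × (Fin N → A), occ γ μ π p q' * jointP p q'.1 q'.2 s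

lemma occ_nonneg
    (hγ0 : 0 ≤ γ) (hp0 : ∀ s a s', 0 ≤ p s a s') (hμ0 : ∀ s, 0 ≤ μ s) (hπ0 : ∀ s a, 0 ≤ π s a)
    (q : (Fin N → S) × (Fin N → A)) : 0 ≤ occ γ μ π p q :=
  tsum_nonneg fun t => mul_nonneg (pow_nonneg hγ0 t) (jsa_nonneg μ π p hp0 hμ0 hπ0 t q)

lemma flow_nonneg
    (hγ0 : 0 ≤ γ) (hp0 : ∀ s a s', 0 ≤ p s a s') (hμ0 : ∀ s, 0 ≤ μ s) (hπ0 : ∀ s a, 0 ≤ π s a)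
    (s : Fin N → S) : 0 ≤ flow γ μ π p s :=
  add_nonneg (hμ0 s) (mul_nonneg hγ0 (Finset.sum_nonneg fun q _ =>
    mul_nonneg (occ_nonneg γ μ π p hγ0 hp0 hμ0 hπ0 q) (jointP_nonneg p hp0 _ _ _)))


lemma occ_summable
    (hγ0 : 0 ≤ γ) (hγ1 : γ < 1) (hp0 : ∀ s a s', 0 ≤ p s a s') (hp1 : ∀ s a, ∑ s', p s a s' = 1)
    (hμ0 : ∀ s, 0 ≤ μ s) (hμ1 : ∑ s, μ s = 1) (hπ0 : ∀ s a, 0 ≤ π s a) (hπ1 : ∀ s, ∑ a, π s a = 1)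
    (q : (Fin N → S) × (Fin N → A)) :
    Summable fun t : ℕ => γ ^ t * jsaDist μ π p t q := by
  refine Summable.of_nonneg_of_le
    (fun t => mul_nonneg (pow_nonneg hγ0 t) (jsa_nonneg μ π p hp0 hμ0 hπ0 t q)) (fun t => ?_)
    (summable_geometric_of_lt_one hγ0 hγ1)
  have h1 : jsaDist μ π p t q ≤ 1 := by
    rw [← jsa_sum μ π p hp1 hμ1 hπ1 t]
    exact Finset.single_le_sum (f := jsaDist μ π p t)
      (fun q _ => jsa_nonneg μ π p hp0 hμ0 hπ0 t q) (Finset.mem_univ q)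
  exact mul_le_of_le_one_right (pow_nonneg hγ0 t) h1

lemma tsum_occ
    (hγ0 : 0 ≤ γ) (hγ1 : γ < 1) (hp0 : ∀ s a s', 0 ≤ p s a s') (hp1 : ∀ s a, ∑ s', p s a s' = 1)
    (hμ0 : ∀ s, 0 ≤ μ s) (hμ1 : ∑ s, μ s = 1) (hπ0 : ∀ s a, 0 ≤ π s a) (hπ1 : ∀ s, ∑ a, π s a = 1)
    (f : ((Fin N → S) × (Fin N → A)) → ℝ) :
    ∑' t : ℕ, γ ^ t * ∑ q, jsaDist μ π p t q * f q = ∑ q, occ γ μ π p q * f q := by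
  have hs := occ_summable γ μ π p hγ0 hγ1 hp0 hp1 hμ0 hμ1 hπ0 hπ1
  simp only [occ, ← tsum_mul_right]
  rw [← Summable.tsum_finsetSum (fun q _ => (hs q).mul_right (f q))]
  congr 1; ext t
  rw [Finset.mul_sum]
  exact Finset.sum_congr rfl fun q _ => by ring

lemma occ_eq
    (hγ0 : 0 ≤ γ) (hγ1 : γ < 1) (hp0 : ∀ s a s', 0 ≤ p s a s') (hp1 : ∀ s a, ∑ s', p s a s' = 1)
    (hμ0 : ∀ s, 0 ≤ μ s) (hμ1 : ∑ s, μ s = 1) (hπ0 : ∀ s a, 0 ≤ π s a) (hπ1 : ∀ s, ∑ a, π s a = 1)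
    (q : (Fin N → S) × (Fin N → A)) :
    occ γ μ π p q = π q.1 q.2 * flow γ μ π p q.1 := by
  have hs := occ_summable γ μ π p hγ0 hγ1 hp0 hp1 hμ0 hμ1 hπ0 hπ1
  unfold flow
  rw [← tsum_occ γ μ π p hγ0 hγ1 hp0 hp1 hμ0 hμ1 hπ0 hπ1, occ, (hs q).tsum_eq_zero_add]
  simp only [jsaDist, pow_zero, one_mul]
  rw [mul_add, ← mul_assoc, ← tsum_mul_left]
  congr 1
  · ring
  · congr 1; ext t; ring

lemma flow_unique
    (hγ0 : 0 ≤ γ) (hγ1 : γ < 1) (hp0 : ∀ s a s', 0 ≤ p s a s') (hp1 : ∀ s a, ∑ s', p s a s' = 1)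
    (hπ0 : ∀ s a, 0 ≤ π s a) (hπ1 : ∀ s, ∑ a, π s a = 1)
    (y z : (Fin N → S) → ℝ)
    (hy : ∀ s, y s = μ s + γ * ∑ q : (Fin N → S) × (Fin N → A),
      (π q.1 q.2 * y q.1) * jointP p q.1 q.2 s)
    (hz : ∀ s, z s = μ s + γ * ∑ q : (Fin N → S) × (Fin N → A),
      (π q.1 q.2 * z q.1) * jointP p q.1 q.2 s) : y = z := by
  have hd : ∀ s, |y s - z s| ≤ γ * ∑ q : (Fin N → S) × (Fin N → A),
      (π q.1 q.2 * |y q.1 - z q.1|) * jointP p q.1 q.2 s := by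
    intro s
    have : y s - z s = γ * ∑ q : (Fin N → S) × (Fin N → A),
      (π q.1 q.2 * (y q.1 - z q.1)) * jointP p q.1 q.2 s := by
      rw [hy s, hz s, add_sub_add_left_eq_sub, ← mul_sub, ← Finset.sum_sub_distrib]
      congr 1
      exact Finset.sum_congr rfl fun q _ => by ring
    rw [this, abs_mul, abs_of_nonneg hγ0]
    refine mul_le_mul_of_nonneg_left ?_ hγ0
    refine (Finset.abs_sum_le_sum_abs _ _).trans (le_of_eq ?_)
    refine Finset.sum_congr rfl fun q _ => ?_
    rw [abs_mul, abs_mul, abs_of_nonneg (hπ0 _ _), abs_of_nonneg (jointP_nonneg p hp0 _ _ _)]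
  have hsum : ∑ s, |y s - z s| ≤ γ * ∑ s, |y s - z s| := by
    refine (Finset.sum_le_sum fun s _ => hd s).trans (le_of_eq ?_)
    rw [← Finset.mul_sum, Finset.sum_comm]
    simp only [← Finset.mul_sum, jointP_sum p hp1, mul_one]
    rw [Fintype.sum_prod_type]
    simp only [← Finset.sum_mul, hπ1, one_mul]
  have h0 : 0 ≤ ∑ s, |y s - z s| := Finset.sum_nonneg fun _ _ => abs_nonneg _
  have h1 : ∑ s, |y s - z s| = 0 := by nlinarith
  ext s
  have := (Finset.sum_eq_zero_iff_of_nonneg (fun _ _ => abs_nonneg _)).1 h1 s (Finset.mem_univ s)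
  exact sub_eq_zero.1 (abs_eq_zero.1 this)

end helpers

theorem stmt16 {N : ℕ} {S A : Type*} [Fintype S] [Fintype A]
    (hN : 0 < N)
    (γ : ℝ) (hγ0 : 0 ≤ γ) (hγ1 : γ < 1)
    (p : S → A → S → ℝ) (hp0 : ∀ s a s', 0 ≤ p s a s')
    (hp1 : ∀ s a, ∑ s', p s a s' = 1)
    (r0 : S → A → ℝ)
    (μ : (Fin N → S) → ℝ) (hμ0 : ∀ s, 0 ≤ μ s) (hμ1 : ∑ s, μ s = 1)
    (hμperm : ∀ (Q : Equiv.Perm (Fin N)) (s : Fin N → S), μ (s ∘ Q) = μ s)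
    (π : (Fin N → S) → (Fin N → A) → ℝ)
    (hπ0 : ∀ s a, 0 ≤ π s a) (hπ1 : ∀ s, ∑ a, π s a = 1) :
    ∃ πb : (Fin N → S) → (Fin N → A) → ℝ,
      (∀ s a, 0 ≤ πb s a) ∧ (∀ s, ∑ a, πb s a = 1) ∧
      (∀ (Q : Equiv.Perm (Fin N)) (s : Fin N → S) (a : Fin N → A),
        πb (s ∘ Q) (a ∘ Q) = πb s a) ∧
      (∀ n : Fin N,
        jVal γ μ πb p r0 n = (1 / N : ℝ) * ∑ m, jVal γ μ π p r0 m) := by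
  classical
  set c : ℝ := (Fintype.card (Equiv.Perm (Fin N)) : ℝ)⁻¹ with hc
  have hcpos : 0 < c := inv_pos.2 (Nat.cast_pos.2 Fintype.card_pos)
  have hcsum : ∀ x : ℝ, c * ∑ _Q : Equiv.Perm (Fin N), x = x := by
    intro x
    rw [Finset.sum_const, Finset.card_univ, nsmul_eq_mul, ← mul_assoc, hc,
      inv_mul_cancel₀ (Nat.cast_ne_zero.2 Fintype.card_ne_zero), one_mul]
  have hocc := occ_eq γ μ π p hγ0 hγ1 hp0 hp1 hμ0 hμ1 hπ0 hπ1
  have hY0 := flow_nonneg γ μ π p hγ0 hp0 hμ0 hπ0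
  have hO0 := occ_nonneg γ μ π p hγ0 hp0 hμ0 hπ0
  set X : ((Fin N → S) × (Fin N → A)) → ℝ := occ γ μ π p with hX
  set Y : (Fin N → S) → ℝ := flow γ μ π p with hY
  set Xb : (Fin N → S) → (Fin N → A) → ℝ :=
    fun s a => c * ∑ Q : Equiv.Perm (Fin N), X (s ∘ Q, a ∘ Q) with hXb
  set Yb : (Fin N → S) → ℝ := fun s => c * ∑ Q : Equiv.Perm (Fin N), Y (s ∘ Q) with hYb
  set πf : (Fin N → S) → (Fin N → A) → ℝ :=
    fun s a => c * ∑ Q : Equiv.Perm (Fin N), π (s ∘ Q) (a ∘ Q) with hπf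
  have hXb0 : ∀ s a, 0 ≤ Xb s a := fun s a =>
    mul_nonneg hcpos.le (Finset.sum_nonneg fun Q _ => hO0 _)
  have hYb0 : ∀ s, 0 ≤ Yb s := fun s =>
    mul_nonneg hcpos.le (Finset.sum_nonneg fun Q _ => hY0 _)
  have hXY : ∀ s, ∑ a, Xb s a = Yb s := by
    intro s
    simp only [hXb, hYb]
    rw [← Finset.mul_sum, Finset.sum_comm]
    congr 1
    refine Finset.sum_congr rfl fun Q _ => ?_
    rw [sum_perm Q (fun a => X (s ∘ Q, a))]
    simp only [hocc, ← Finset.sum_mul, hπ1, one_mul]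
  -- reindexing sums over permutations
  have hre : ∀ (Q : Equiv.Perm (Fin N)) (f : Equiv.Perm (Fin N) → ℝ),
      ∑ R, f (Q * R) = ∑ R, f R := fun Q f => Equiv.sum_comp (Equiv.mulLeft Q) f
  have hXbp : ∀ (Q : Equiv.Perm (Fin N)) s a, Xb (s ∘ Q) (a ∘ Q) = Xb s a := by
    intro Q s a
    simp only [hXb]
    rw [← hre Q (fun R => X (s ∘ R, a ∘ R))]
    rfl
  have hYbp : ∀ (Q : Equiv.Perm (Fin N)) s, Yb (s ∘ Q) = Yb s := by
    intro Q s
    simp only [hYb]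
    rw [← hre Q (fun R => Y (s ∘ R))]
    rfl
  have hπfp : ∀ (Q : Equiv.Perm (Fin N)) s a, πf (s ∘ Q) (a ∘ Q) = πf s a := by
    intro Q s a
    simp only [hπf]
    rw [← hre Q (fun R => π (s ∘ R) (a ∘ R))]
    rfl
  have hπf1 : ∀ s, ∑ a, πf s a = 1 := by
    intro s
    simp only [hπf]
    rw [← Finset.mul_sum, Finset.sum_comm, ← hcsum 1]
    congr 1
    refine Finset.sum_congr rfl fun Q _ => ?_
    rw [sum_perm Q (fun a => π (s ∘ Q) a), hπ1]
  set πb : (Fin N → S) → (Fin N → A) → ℝ :=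
    fun s a => if Yb s = 0 then πf s a else Xb s a / Yb s with hπb
  have hπb0 : ∀ s a, 0 ≤ πb s a := by
    intro s a
    simp only [hπb]
    split_ifs
    · exact mul_nonneg hcpos.le (Finset.sum_nonneg fun Q _ => hπ0 _ _)
    · exact div_nonneg (hXb0 s a) (hYb0 s)
  have hπb1 : ∀ s, ∑ a, πb s a = 1 := by
    intro s
    simp only [hπb]
    split_ifs with h
    · exact hπf1 s
    · rw [← Finset.sum_div, hXY, div_self h]
  have hXπ : ∀ s a, Xb s a = πb s a * Yb s := by
    intro s a
    simp only [hπb]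
    split_ifs with h
    · rw [h, mul_zero]
      have h2 := hXY s
      rw [h] at h2
      exact (Finset.sum_eq_zero_iff_of_nonneg (fun a _ => hXb0 s a)).1 h2 a (Finset.mem_univ a)
    · rw [div_mul_cancel₀ _ h]
  have hflowb : ∀ s, Yb s = μ s + γ * ∑ q : (Fin N → S) × (Fin N → A),
      (πb q.1 q.2 * Yb q.1) * jointP p q.1 q.2 s := by
    intro s
    have h1 : ∀ Q : Equiv.Perm (Fin N), Y (s ∘ Q) = μ s + γ *
        ∑ q : (Fin N → S) × (Fin N → A), X (q.1 ∘ Q, q.2 ∘ Q) * jointP p q.1 q.2 s := by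
      intro Q
      rw [hY, flow, hμperm, ← sum_perm2 Q]
      simp only [jointP_perm]
      rfl
    simp only [← hXπ]
    simp only [hYb, hXb, h1]
    rw [Finset.sum_add_distrib, mul_add, hcsum, ← Finset.mul_sum, Finset.sum_comm]
    congr 1
    simp only [← Finset.sum_mul, mul_assoc, ← Finset.mul_sum]
    ring
  have hoccb := occ_eq γ μ πb p hγ0 hγ1 hp0 hp1 hμ0 hμ1 hπb0 hπb1
  have hYeq : flow γ μ πb p = Yb := by
    refine flow_unique γ μ πb p hγ0 hγ1 hp0 hp1 hπb0 hπb1 _ _ (fun s => ?_) hflowb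
    simp only [← hoccb]
    rfl
  have hXeq : ∀ q, occ γ μ πb p q = Xb q.1 q.2 := by
    intro q
    rw [hoccb, hYeq, hXπ]
  set V : Fin N → ℝ := fun n => jVal γ μ π p r0 n with hV
  have hVX : ∀ n, V n = ∑ q : (Fin N → S) × (Fin N → A), X q * r0 (q.1 n) (q.2 n) := fun n =>
    tsum_occ γ μ π p hγ0 hγ1 hp0 hp1 hμ0 hμ1 hπ0 hπ1 (fun q => r0 (q.1 n) (q.2 n))
  have hVb : ∀ n, jVal γ μ πb p r0 n = c * ∑ Q : Equiv.Perm (Fin N), V (Q n) := by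
    intro n
    have h1 : jVal γ μ πb p r0 n = ∑ q : (Fin N → S) × (Fin N → A),
        occ γ μ πb p q * r0 (q.1 n) (q.2 n) :=
      tsum_occ γ μ πb p hγ0 hγ1 hp0 hp1 hμ0 hμ1 hπb0 hπb1 (fun q => r0 (q.1 n) (q.2 n))
    rw [h1]
    simp only [hXeq, hXb, mul_assoc, Finset.sum_mul]
    rw [← Finset.mul_sum, Finset.sum_comm]
    congr 1
    rw [← Equiv.sum_comp (Equiv.inv (Equiv.Perm (Fin N)))]
    refine Finset.sum_congr rfl fun Q _ => ?_
    rw [hVX, ← sum_perm2 Q⁻¹ (fun q => X q * r0 (q.1 (Q n)) (q.2 (Q n)))]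
    simp
  have hconst : ∀ n m, jVal γ μ πb p r0 n = jVal γ μ πb p r0 m := by
    intro n m
    rw [hVb, hVb, ← Equiv.sum_comp (Equiv.mulRight (Equiv.swap n m)) (fun Q => V (Q n))]
    simp
  have htot : ∑ n, jVal γ μ πb p r0 n = ∑ m, V m := by
    simp only [hVb]
    rw [← Finset.mul_sum, Finset.sum_comm, ← hcsum (∑ m, V m)]
    congr 1
    refine Finset.sum_congr rfl fun Q _ => ?_
    exact Equiv.sum_comp Q V
  refine ⟨πb, hπb0, hπb1, ?_, ?_⟩
  · intro Q s a
    simp only [hπb, hXbp, hYbp, hπfp]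
  · intro n
    have hN' : (N : ℝ) ≠ 0 := Nat.cast_ne_zero.2 hN.ne'
    have h2 : ∑ m, jVal γ μ πb p r0 m = N * jVal γ μ πb p r0 n := by
      rw [Finset.sum_congr rfl (fun m _ => hconst m n)]
      simp
    rw [h2] at htot
    rw [← htot]
    field_simp
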